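/- Let k = ℝ(s) be the field of rational functions in one variable s over ℝ (RatFunc ℝ, with s the generator X). For all positive real numbers R, L, C, each of the subspaces ■(R) = {((φ₁,I₁),(φ₂,I₂)) ∈ k² × k² : φ₂ − φ₁ = R·I₁ and I₁ = I₂}, ■(L) = {((φ₁,I₁),(φ₂,I₂)) : φ₂ − φ₁ = s·L·I₁ and I₁ = I₂}, and ■(C) = {((φ₁,I₁),(φ₂,I₂)) : s·C·(φ₂ − φ₁) = I₁ and I₁ = I₂} (the behaviors of a resistor of resistance R, an inductor of inductance L, and a capacitor of capacitance C) is a Lagrangian subspace of k² × k² with respect to the form Ω(((φ,I),(φ',I')),((ψ,J),(ψ',J'))) = −ω((φ,I),(ψ,J)) + ω((φ',I'),(ψ',J')). -/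

import Mathlib

open Module

/-- The standard symplectic form on `k²`: `ω((φ,I),(φ',I')) = φ·I' − φ'·I`. -/
def sympForm (k : Type*) [Field k] : (k × k) → (k × k) → k :=
  fun p q => p.1 * q.2 - q.1 * p.2

/-- The field `k = ℝ(s)` of rational functions in one variable over `ℝ`. -/
abbrev K : Type := RatFunc ℝ

/-- The voltage-current relation `φ₂ − φ₁ = z·I₁`, `I₁ = I₂` of an impedance `z` over any field
is a Lagrangian subspace. -/
theorem impedance_behavior_lagrangian {k : Type*} [Field k] (z : k) :
    ∃ M : Submodule k ((k × k) × (k × k)),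
      (M : Set ((k × k) × (k × k))) = {p | p.2.1 - p.1.1 = z * p.1.2 ∧ p.1.2 = p.2.2} ∧
      (∀ x ∈ M, ∀ y ∈ M, -sympForm k x.1 y.1 + sympForm k x.2 y.2 = 0) ∧
      2 * finrank k M = finrank k ((k × k) × (k × k)) := by
  let f : (k × k) →ₗ[k] (k × k) × (k × k) :=
    LinearMap.prod LinearMap.id
      (LinearMap.prod (LinearMap.fst k k k + z • LinearMap.snd k k k) (LinearMap.snd k k k))
  have hf (p : k × k) : f p = (p, (p.1 + z * p.2, p.2)) := rfl
  have hf_inj : Function.Injective f := fun p q h => congrArg Prod.fst h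
  refine ⟨LinearMap.range f, ?_, ?_, ?_⟩
  · ext ⟨⟨φ₁, I₁⟩, φ₂, I₂⟩
    constructor
    · rintro ⟨p, h⟩
      rw [hf] at h
      cases h
      simp
    · rintro ⟨hφ : φ₂ - φ₁ = z * I₁, hI : I₁ = I₂⟩
      refine ⟨(φ₁, I₁), ?_⟩
      rw [hf, ← hφ, ← hI, add_sub_cancel]
  · rintro _ ⟨p, rfl⟩ _ ⟨q, rfl⟩
    simp only [hf, sympForm]
    ring
  · rw [LinearMap.finrank_range_of_inj hf_inj]
    simp

/-- Over `k = ℝ(s)`, the behaviors of a resistor of resistance `R`,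
an inductor of inductance `L`, and a capacitor of capacitance `C` (for positive reals
`R`, `L`, `C`) are Lagrangian subspaces of `k² × k²` with respect to the form
`Ω(x,y) = −ω(x₁,y₁) + ω(x₂,y₂)`. -/
theorem RLC_behaviors_lagrangian (R L C : ℝ) (hR : 0 < R) (hL : 0 < L) (hC : 0 < C) :
    -- resistor: φ₂ − φ₁ = R·I₁, I₁ = I₂
    (∃ M : Submodule K ((K × K) × (K × K)),
      (M : Set ((K × K) × (K × K))) =
        {p | p.2.1 - p.1.1 = RatFunc.C R * p.1.2 ∧ p.1.2 = p.2.2} ∧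
      (∀ x ∈ M, ∀ y ∈ M, -sympForm K x.1 y.1 + sympForm K x.2 y.2 = 0) ∧
      2 * finrank K M = finrank K ((K × K) × (K × K))) ∧
    -- inductor: φ₂ − φ₁ = s·L·I₁, I₁ = I₂
    (∃ M : Submodule K ((K × K) × (K × K)),
      (M : Set ((K × K) × (K × K))) =
        {p | p.2.1 - p.1.1 = RatFunc.X * RatFunc.C L * p.1.2 ∧ p.1.2 = p.2.2} ∧
      (∀ x ∈ M, ∀ y ∈ M, -sympForm K x.1 y.1 + sympForm K x.2 y.2 = 0) ∧
      2 * finrank K M = finrank K ((K × K) × (K × K))) ∧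
    -- capacitor: s·C·(φ₂ − φ₁) = I₁, I₁ = I₂
    (∃ M : Submodule K ((K × K) × (K × K)),
      (M : Set ((K × K) × (K × K))) =
        {p | RatFunc.X * RatFunc.C C * (p.2.1 - p.1.1) = p.1.2 ∧ p.1.2 = p.2.2} ∧
      (∀ x ∈ M, ∀ y ∈ M, -sympForm K x.1 y.1 + sympForm K x.2 y.2 = 0) ∧
      2 * finrank K M = finrank K ((K × K) × (K × K))) := by
  refine ⟨impedance_behavior_lagrangian _, impedance_behavior_lagrangian _, ?_⟩
  have hz : (RatFunc.X * RatFunc.C C : K) ≠ 0 :=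
    mul_ne_zero RatFunc.X_ne_zero ((map_ne_zero RatFunc.C).2 hC.ne')
  obtain ⟨M, hM, h⟩ := impedance_behavior_lagrangian (RatFunc.X * RatFunc.C C : K)⁻¹
  refine ⟨M, hM.trans (Set.ext fun p => and_congr_left' ?_), h⟩
  exact eq_inv_mul_iff_mul_eq₀ hz
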